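/- arXiv:0708.1877 — 2 statements merged into one kernel-verified Lean document; each statement's English description precedes it below -/
import Mathlib

section
/- The number of σ-ary de Bruijn sequences of order k (cyclic sequences over an alphabet of size σ in which every σ-ary k-tuple occurs exactly once as a cyclic substring) is (σ!)^(σ^(k-1)). -/
/-- cyclic σ-ary de Bruijn sequence of order k: length σ^k, and every k-tuple
occurs exactly once as a cyclic substring -/
def IsDeBruijn (σ k : ℕ) (s : List (Fin σ)) : Prop :=
  s.length = σ ^ k ∧
    ∀ w : List (Fin σ), w.length = k →
      ∃! i, i < s.length ∧ ((s ++ s).drop i).take k = w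

open Finset Matrix

open Classical in
theorem det_functionalGraph {V : Type*} [Fintype V] [DecidableEq V] (g : V → V) (r : V) :
    (Matrix.of fun v => if v = r then (Pi.single r 1 : V → ℚ)
        else Pi.single v 1 - Pi.single (g v) 1).det =
      if ∀ v, ∃ n, g^[n] v = r then 1 else 0 := by
  set M : Matrix V V ℚ := Matrix.of fun v => if v = r then (Pi.single r 1 : V → ℚ)
        else Pi.single v 1 - Pi.single (g v) 1 with hM
  split_ifs with h
  · set b : V → ℕᵒᵈ := fun v => OrderDual.toDual (Nat.find (h v)) with hb
    have hlt : ∀ v, v ≠ r → Nat.find (h (g v)) < Nat.find (h v) := by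
      intro v hv
      have hs := Nat.find_spec (h v)
      obtain hn | ⟨n, hn⟩ := Nat.eq_zero_or_eq_succ_pred (Nat.find (h v)) |>.imp_right
        fun e => (⟨_, e⟩ : ∃ n, Nat.find (h v) = Nat.succ n)
      · rw [hn] at hs
        exact absurd hs hv
      · rw [hn] at hs ⊢
        exact Nat.lt_succ_of_le (Nat.find_min' _ hs)
    have hzero : ∀ i j, i ≠ j → b j ≤ b i → M i j = 0 := by
      intro i j hij hle
      by_cases hi : i = r
      · subst hi
        simp [hM, hij.symm]
      · have hgi : g i ≠ j := by
          rintro rfl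
          exact absurd (hlt i hi) (not_lt.mpr hle)
        simp [hM, hi, hij.symm, hgi.symm]
    have hbt : M.BlockTriangular b := fun i j hij =>
      hzero i j (by rintro rfl; exact lt_irrefl _ hij) hij.le
    rw [hbt.det]
    refine Finset.prod_eq_one fun a _ => ?_
    suffices hs : M.toSquareBlock b a = 1 by rw [hs, Matrix.det_one]
    ext i j
    by_cases hij : i = j
    · subst hij
      simp only [Matrix.toSquareBlock_def, Matrix.of_apply, Matrix.one_apply_eq]
      by_cases hi : (i : V) = r
      · simp [hM, hi]
      · have : g i ≠ i := fun e => absurd (hlt i hi) (by rw [e]; exact lt_irrefl _)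
        simp [hM, hi, this.symm]
    · rw [Matrix.one_apply_ne hij]
      exact hzero _ _ (fun e => hij (Subtype.ext e)) (by rw [i.2, j.2])
  · rw [← Matrix.exists_mulVec_eq_zero_iff]
    push Not at h
    obtain ⟨v₀, hv₀⟩ := h
    refine ⟨fun v => if ∃ n, g^[n] v = r then 0 else 1, fun e => ?_, ?_⟩
    · have := congrFun e v₀
      simp [hv₀] at this
    · ext v
      by_cases hv : v = r
      · subst hv
        have : ∃ n, g^[n] v = v := ⟨0, rfl⟩
        simp [hM, Matrix.mulVec, this]
      · have : (∃ n, g^[n] v = r) ↔ ∃ n, g^[n] (g v) = r := by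
          constructor
          · rintro ⟨_ | n, hn⟩
            · exact absurd hn hv
            · exact ⟨n, hn⟩
          · rintro ⟨n, hn⟩
            exact ⟨n + 1, hn⟩
        have hrow : M v = Pi.single v 1 - Pi.single (g v) 1 := by
          rw [hM]
          exact if_neg hv
        rw [Matrix.mulVec, hrow, sub_dotProduct]
        simp [this]

theorem det_updateRow_eq_of_sum_eq {V K : Type*} [Fintype V] [DecidableEq V] [Nonempty V] [Field K]
    {L : Matrix V V K} (hL : ∀ v, ∑ w, L v w = 0) (r : V) {x y : V → K}
    (hxy : ∑ w, x w = ∑ w, y w) : (L.updateRow r x).det = (L.updateRow r y).det := by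
  have h0 : (L.updateRow r (x - y)).det = 0 := by
    rw [← Matrix.exists_mulVec_eq_zero_iff]
    refine ⟨1, one_ne_zero, ?_⟩
    ext v
    by_cases hv : v = r
    · subst hv
      simp [Matrix.mulVec, dotProduct, hxy]
    · simp [Matrix.mulVec, dotProduct, hv, hL]
  have := Matrix.det_updateRow_add L r (x - y) y
  rwa [sub_add_cancel, h0, zero_add] at this

theorem det_scalar_sub_of_isNilpotent {V K : Type*} [Fintype V] [DecidableEq V] [Field K]
    {N : Matrix V V K} (hN : IsNilpotent N) (t : K) :
    (t • 1 - N).det = t ^ Fintype.card V := by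
  have := Matrix.isNilpotent_charpoly_sub_pow_of_isNilpotent hN
  rw [isNilpotent_iff_eq_zero, sub_eq_zero] at this
  rw [Matrix.smul_one_eq_diagonal, ← Matrix.scalar_apply, ← Matrix.eval_charpoly, this]
  simp

/-- The transition matrix of a regular digraph, given by its successor function. -/
def transitionMatrix {V : Type*} [DecidableEq V] {d : ℕ} (δ : V → Fin d → V) : Matrix V V ℚ :=
  Matrix.of fun v => ∑ a, Pi.single (δ v a) 1

theorem card_mul_card_reaching {V : Type*} [Fintype V] [DecidableEq V] {d m : ℕ}
    (δ : V → Fin d → V) (hin : ∀ w, #{p : V × Fin d | δ p.1 p.2 = w} = d)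
    (hpow : ∀ u v, (transitionMatrix δ ^ m) u = (transitionMatrix δ ^ m) v) (r : V) :
    Fintype.card V * Nat.card {f : V → Fin d // ∀ v, ∃ n, (fun u => δ u (f u))^[n] v = r} =
      d ^ Fintype.card V := by
  classical
  have : Nonempty V := ⟨r⟩
  set A := transitionMatrix δ with hA
  have hcol : ∀ w, ∑ v, A v w = d := by
    intro w
    rw [← hin w, Finset.card_filter, Fintype.sum_prod_type]
    simp [hA, transitionMatrix, Pi.single_apply, eq_comm]
  have hrow : ∀ v, ∑ w, A v w = d := by
    intro v
    simp only [hA, transitionMatrix, Matrix.of_apply, Finset.sum_apply]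
    rw [Finset.sum_comm]
    simp
  set L : Matrix V V ℚ := (d : ℚ) • 1 - A with hL
  have hLrow : ∀ v, ∑ w, L v w = 0 := by
    intro v
    simp [hL, hrow, Matrix.one_apply]
  set C : Matrix V V ℚ := A - Matrix.vecMulVec (Pi.single r (d : ℚ)) 1 with hC
  have hAcol : 1 ᵥ* A = (d : ℚ) • 1 := by
    ext w
    simp [Matrix.vecMul, dotProduct, hcol]
  have hCcol : 1 ᵥ* C = 0 := by
    rw [hC, Matrix.vecMul_sub, hAcol, Matrix.vecMul_vecMulVec]
    simp
  have hC2 : C * C = A * C := by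
    conv_lhs => rw [hC, ← hC, Matrix.sub_mul, Matrix.vecMulVec_mul, hCcol]
    simp
  have hCpow : ∀ j, C ^ (j + 1) = A ^ j * C := by
    intro j
    induction j with
    | zero => simp
    | succ j ih => rw [pow_succ, ih, mul_assoc, hC2, pow_succ, mul_assoc]
  have hApow : ∀ j, 1 ᵥ* (A ^ j) = (d : ℚ) ^ j • 1 := by
    intro j
    induction j with
    | zero => simp
    | succ j ih =>
      rw [pow_succ, ← Matrix.vecMul_vecMul, ih, Matrix.smul_vecMul, hAcol, smul_smul, pow_succ]
  have hnil : IsNilpotent C := by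
    refine ⟨m + 1, ?_⟩
    rw [hCpow]
    have hs : 1 ᵥ* (A ^ m * C) = 0 := by
      rw [← Matrix.vecMul_vecMul, hApow, Matrix.smul_vecMul, hCcol, smul_zero]
    ext u w
    have hsw := congrFun hs w
    have hc : ∀ v, (A ^ m * C) v w = (A ^ m * C) u w := by
      intro v
      rw [Matrix.mul_apply, Matrix.mul_apply, hpow v u]
    simpa [Matrix.vecMul, dotProduct, hc] using hsw
  have hdet := det_scalar_sub_of_isNilpotent hnil (d : ℚ)
  have hupd : (d : ℚ) • 1 - C = L.updateRow r (L r + fun _ => (d : ℚ)) := by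
    ext v w
    by_cases hv : v = r
    · subst hv
      simp [hC, hL]
      ring
    · simp [hC, hL, hv]
  have hcount : (Nat.card {f : V → Fin d // ∀ v, ∃ n, (fun u => δ u (f u))^[n] v = r} : ℚ) =
      (L.updateRow r (Pi.single r (d : ℚ))).det := by
    have hsum : L.updateRow r (Pi.single r (d : ℚ)) = Matrix.of fun v => ∑ a,
        if v = r then (Pi.single r 1 : V → ℚ) else Pi.single v 1 - Pi.single (δ v a) 1 := by
      ext v w
      by_cases hv : v = r
      · subst hv
        simp [Pi.single_apply]
      · simp [hL, hA, transitionMatrix, hv, Finset.sum_apply, Matrix.one_eq_pi_single]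
    rw [hsum]
    change _ = Matrix.detRowAlternating.toMultilinearMap (fun v => ∑ a,
        if v = r then (Pi.single r 1 : V → ℚ) else Pi.single v 1 - Pi.single (δ v a) 1)
    rw [MultilinearMap.map_sum, Nat.card_eq_fintype_card, Fintype.card_subtype,
      Finset.natCast_card_filter]
    exact Finset.sum_congr rfl fun f _ => (det_functionalGraph (fun u => δ u (f u)) r).symm
  have hfin : (L.updateRow r (L r + fun _ => (d : ℚ))).det =
      (L.updateRow r ((Fintype.card V : ℚ) • Pi.single r (d : ℚ))).det := by
    apply det_updateRow_eq_of_sum_eq hLrow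
    simp [Finset.sum_add_distrib, hLrow, Pi.single_apply]
  rw [hupd, hfin, Matrix.det_updateRow_smul, ← hcount] at hdet
  exact_mod_cast hdet

/-- An `N`-periodic sequence of edges, each ending where the next one starts, that runs through
every edge exactly once per period. -/
structure IsEulerCircuit {V : Type*} {d : ℕ} (δ : V → Fin d → V) (N : ℕ) (e : ℕ → V × Fin d) :
    Prop where
  periodic : ∀ i, e (i + N) = e i
  chain : ∀ i, δ (e i).1 (e i).2 = (e (i + 1)).1
  existsUnique : ∀ p, ∃! i, i < N ∧ e i = p

/-- During the first `N` steps of `e`, every vertex `v` is left along the edges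
`π v (d - 1)`, …, `π v 1`, `π v 0`, in this order. -/
def ExitsInOrder {V : Type*} {d : ℕ} (N : ℕ) (e : ℕ → V × Fin d) (π : V → Equiv.Perm (Fin d)) :
    Prop :=
  ∀ v a b i j, a < b → i < N → j < N → e i = (v, π v a) → e j = (v, π v b) → j < i

/-- The position and the number of exits from each vertex, for the walk from `r` that leaves every
vertex `v` along `π v d`, …, `π v 1`, `π v 0`, in this order. -/
def exitWalk {V : Type*} [DecidableEq V] {d : ℕ} (δ : V → Fin (d + 1) → V) (r : V)
    (π : V → Equiv.Perm (Fin (d + 1))) : ℕ → V × (V → ℕ)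
  | 0 => (r, 0)
  | i + 1 =>
    let s := exitWalk δ r π i
    (δ s.1 (π s.1 ⟨d - s.2 s.1, by omega⟩), Function.update s.2 s.1 (s.2 s.1 + 1))

theorem exists_isEulerCircuit {V : Type*} [Fintype V] [DecidableEq V] {d : ℕ}
    (δ : V → Fin (d + 1) → V) (hin : ∀ w, #{p : V × Fin (d + 1) | δ p.1 p.2 = w} = d + 1)
    (r : V) (π : V → Equiv.Perm (Fin (d + 1)))
    (hπ : ∀ v, ∃ n, (fun u => δ u (π u 0))^[n] v = r) :
    ∃ e, IsEulerCircuit δ (Fintype.card V * (d + 1)) e ∧ (e 0).1 = r ∧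
      ExitsInOrder (Fintype.card V * (d + 1)) e π := by
  set N := Fintype.card V * (d + 1) with hN
  set v : ℕ → V := fun i => (exitWalk δ r π i).1 with hv
  set c : ℕ → V → ℕ := fun i => (exitWalk δ r π i).2 with hc
  set E : ℕ → V × Fin (d + 1) := fun i => (v i, π (v i) ⟨d - c i (v i), by omega⟩) with hE
  have hEw : ∀ j w b, E j = (w, π w b) → v j = w ∧ d - c j w = b := by
    intro j w b h
    obtain rfl : v j = w := congrArg Prod.fst h
    exact ⟨rfl, congrArg Fin.val ((π (v j)).injective (congrArg Prod.snd h))⟩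
  have hv0 : v 0 = r := rfl
  have hc0 : ∀ w, c 0 w = 0 := fun w => rfl
  have hvs : ∀ i, δ (E i).1 (E i).2 = v (i + 1) := fun i => rfl
  have hcs : ∀ i w, c (i + 1) w = c i w + if v i = w then 1 else 0 := by
    intro i w
    change Function.update (c i) (v i) (c i (v i) + 1) w = _
    by_cases h : v i = w
    · subst h; simp
    · simp [h, Ne.symm h]
  have hcmono : ∀ w, Monotone fun i => c i w := fun w =>
    monotone_nat_of_le_succ fun i => by rw [hcs]; omega
  have hsum : ∀ i, ∑ w, c i w = i := by
    intro i
    induction i with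
    | zero => simp [hc0]
    | succ i ih => simp [hcs, Finset.sum_add_distrib, ih]
  have hins : ∀ i w, #{j ∈ range i | δ (E j).1 (E j).2 = w} + (if r = w then 1 else 0) =
      c i w + if v i = w then 1 else 0 := by
    intro i w
    induction i with
    | zero => simp [hc0, hv0]
    | succ i ih =>
      rw [hcs, ← ih, Finset.range_add_one, Finset.filter_insert, hvs]
      split_ifs <;> simp_all
  have hstuck : ∃ i, d < c i (v i) := by
    by_contra! h
    have hle : ∀ i w, c i w ≤ d + 1 := by
      intro i w
      induction i with
      | zero => simp [hc0]
      | succ i ih =>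
        rw [hcs]
        split_ifs with hw
        · have := h i; rw [hw] at this; omega
        · omega
    have h1 := Finset.sum_le_sum fun w (_ : w ∈ univ) => hle (N + 1) w
    rw [hsum] at h1
    simp at h1
    omega
  obtain ⟨t, htd, hlt⟩ : ∃ t, d < c t (v t) ∧ ∀ i < t, c i (v i) ≤ d :=
    ⟨Nat.find hstuck, Nat.find_spec hstuck, fun i hi => not_lt.mp (Nat.find_min hstuck hi)⟩
  have hle : ∀ i ≤ t, ∀ w, c i w ≤ d + 1 := by
    intro i
    induction i with
    | zero => simp [hc0]
    | succ i ih =>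
      intro hi w
      have h1 := ih (by omega) w
      have h2 := hlt i (by omega)
      rw [hcs]
      split_ifs with hw
      · rw [hw] at h2; omega
      · omega
  have hct : c t (v t) = d + 1 := le_antisymm (hle t le_rfl _) htd
  have hclt : ∀ i j w, i < j → v i = w → c i w < c j w := by
    intro i j w hij hw
    have h1 := hcs i w
    have h2 : c (i + 1) w ≤ c j w := hcmono w hij
    simp only [hw, if_true] at h1
    omega
  have hinj : ∀ i j, i < j → j < t → E i ≠ E j := by
    intro i j hij hj he
    obtain ⟨h1, h2⟩ := hEw i _ _ he
    have h3 := hclt i j (v j) hij h1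
    have h4 := hlt i (by omega)
    have h5 := hlt j hj
    rw [h1] at h4
    simp only at h2
    omega
  have hinjOn : Set.InjOn E (range t) := by
    intro i hi j hj he
    simp only [coe_range, Set.mem_Iio] at hi hj
    rcases lt_trichotomy i j with h | h | h
    · exact absurd he (hinj i j h hj)
    · exact h
    · exact absurd he.symm (hinj j i h hi)
  have hsub : ∀ w, ({j ∈ range t | δ (E j).1 (E j).2 = w}).image E ⊆
      ({p : V × Fin (d + 1) | δ p.1 p.2 = w} : Finset _) := by
    intro w p hp
    simp only [mem_image, mem_filter] at hp ⊢
    obtain ⟨j, hj, rfl⟩ := hp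
    exact ⟨mem_univ _, hj.2⟩
  have hcard : ∀ w, #(({j ∈ range t | δ (E j).1 (E j).2 = w}).image E) =
      #{j ∈ range t | δ (E j).1 (E j).2 = w} := fun w =>
    Finset.card_image_of_injOn (hinjOn.mono (by exact_mod_cast Finset.filter_subset _ _))
  have hin_le : ∀ w, #{j ∈ range t | δ (E j).1 (E j).2 = w} ≤ d + 1 := by
    intro w
    rw [← hcard]
    exact (Finset.card_le_card (hsub w)).trans_eq (hin w)
  have hin_all : ∀ w, #{j ∈ range t | δ (E j).1 (E j).2 = w} = d + 1 →
      ∀ p : V × Fin (d + 1), δ p.1 p.2 = w → ∃ j < t, E j = p := by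
    intro w hw p hp
    have heq := Finset.eq_of_subset_of_card_le (hsub w) (by rw [hcard, hw, hin])
    have hmem : p ∈ ({p : V × Fin (d + 1) | δ p.1 p.2 = w} : Finset _) := by simpa using hp
    rw [← heq] at hmem
    simp only [mem_image, mem_filter, mem_range] at hmem
    obtain ⟨j, hj, rfl⟩ := hmem
    exact ⟨j, hj.1, rfl⟩
  have hvt : v t = r := by
    have h1 := hins t (v t)
    have h2 := hin_le (v t)
    by_contra hne
    simp only [if_neg (Ne.symm hne), if_true] at h1
    omega
  have hfull_in : ∀ w, c t w = d + 1 → #{j ∈ range t | δ (E j).1 (E j).2 = w} = d + 1 := by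
    intro w hw
    have h1 := hins t w
    rw [hvt] at h1
    omega
  have hfull_iter : ∀ n w, (fun u => δ u (π u 0))^[n] w = r → c t w = d + 1 := by
    intro n
    induction n with
    | zero =>
      intro w hw
      obtain rfl : w = r := hw
      rw [← hct, hvt]
    | succ n ih =>
      intro w hw
      obtain ⟨j, hj, he⟩ := hin_all _ (hfull_in _ (ih _ hw)) (w, π w 0) rfl
      obtain ⟨h1, h3⟩ := hEw j _ _ he
      have h4 := hclt j t w hj h1
      have h5 := hle t le_rfl w
      simp only [Fin.val_zero] at h3
      omega
  have hfull : ∀ w, c t w = d + 1 := fun w => (hπ w).elim fun n hn => hfull_iter n w hn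
  have htN : t = N := by
    rw [← hsum t]
    simp [hfull, hN]
  subst htN
  have hNpos : 0 < N := by
    have : Nonempty V := ⟨r⟩
    rw [hN]; positivity
  have hmod : ∀ i, i < N → i % N = i := fun i => Nat.mod_eq_of_lt
  refine ⟨fun i => E (i % N), ⟨fun i => by simp, fun i => ?_, fun p => ?_⟩, ?_, ?_⟩
  · rw [hvs]
    change v (i % N + 1) = v ((i + 1) % N)
    have hi := Nat.mod_lt i hNpos
    rw [← Nat.mod_add_mod]
    rcases Nat.lt_or_ge (i % N + 1) N with h | h
    · rw [Nat.mod_eq_of_lt h]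
    · have h' : i % N + 1 = N := by omega
      rw [h', hvt, Nat.mod_self, hv0]
  · obtain ⟨j, hj, he⟩ := hin_all _ (hfull_in _ (hfull _)) p rfl
    refine ⟨j, ⟨hj, by simpa only [hmod j hj]⟩, ?_⟩
    rintro i ⟨hi, hei⟩
    simp only [hmod i hi] at hei
    exact hinjOn (by simpa using hi) (by simpa using hj) (hei.trans he.symm)
  · simp [hE, hv0]
  · intro w a b i j hab hi hj hei hej
    simp only [hmod i hi, hmod j hj] at hei hej
    obtain ⟨hvi, ha⟩ := hEw i _ _ hei
    obtain ⟨hvj, hb⟩ := hEw j _ _ hej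
    have h1 := hlt i hi
    have h2 := hlt j hj
    rw [hvi] at h1
    rw [hvj] at h2
    by_contra! hij
    have h3 : c i w ≤ c j w := hcmono w hij
    omega

theorem IsEulerCircuit.eq_of_exitsInOrder {V : Type*} {d N : ℕ} {δ : V → Fin d → V}
    {e e' : ℕ → V × Fin d} {π : V → Equiv.Perm (Fin d)} (hN : 0 < N)
    (he : IsEulerCircuit δ N e) (he' : IsEulerCircuit δ N e') (h0 : (e 0).1 = (e' 0).1)
    (hπ : ExitsInOrder N e π) (hπ' : ExitsInOrder N e' π) : e = e' := by
  have key : ∀ {f f' : ℕ → V × Fin d}, IsEulerCircuit δ N f → IsEulerCircuit δ N f' →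
      ExitsInOrder N f π → ∀ i < N, (∀ j < i, f j = f' j) → ∀ v a b, f i = (v, π v a) →
        f' i = (v, π v b) → ¬ a < b := by
    intro f f' hf hf' hfπ i hi hji v a b ha hb hab
    obtain ⟨j, hj, -⟩ := hf.existsUnique (v, π v b)
    have hlt := hfπ v a b i j hab hi hj.1 ha hj.2
    exact hlt.ne ((hf'.existsUnique _).unique ⟨hj.1, (hji j hlt).symm.trans hj.2⟩ ⟨hi, hb⟩)
  have hlt : ∀ i < N, e i = e' i := by
    intro i
    induction i using Nat.strong_induction_on with
    | _ i ih =>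
      intro hi
      have hv : (e i).1 = (e' i).1 := by
        rcases i with _ | i
        · exact h0
        · rw [← he.chain, ← he'.chain, ih i i.lt_succ_self (by omega)]
      have ha : e i = ((e i).1, π (e i).1 ((π (e i).1).symm (e i).2)) := by simp
      have hb : e' i = ((e i).1, π (e i).1 ((π (e i).1).symm (e' i).2)) := by simp [hv]
      have hle := key he he' hπ i hi (fun j hj => ih j hj (hj.trans hi)) _ _ _ ha hb
      have hge := key he' he hπ' i hi (fun j hj => (ih j hj (hj.trans hi)).symm) _ _ _ hb ha
      rw [ha, hb, le_antisymm (not_lt.mp hge) (not_lt.mp hle)]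
  funext i
  rw [← Function.Periodic.map_mod_nat he.periodic, ← Function.Periodic.map_mod_nat he'.periodic]
  exact hlt _ (Nat.mod_lt _ hN)

theorem IsEulerCircuit.exists_exitsInOrder {V : Type*} {d N : ℕ} {δ : V → Fin d → V}
    {e : ℕ → V × Fin d} (he : IsEulerCircuit δ N e) : ∃ π, ExitsInOrder N e π := by
  choose τ hτ hτu using he.existsUnique
  refine ⟨fun v => Tuple.sort fun a => OrderDual.toDual (τ (v, a)), ?_⟩
  intro v a b i j hab hi hj hei hej
  rw [hτu _ i ⟨hi, hei⟩, hτu _ j ⟨hj, hej⟩]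
  refine lt_of_le_of_ne (Tuple.monotone_sort (fun a => OrderDual.toDual (τ (v, a))) hab.le)
    fun h => hab.ne' ?_
  have := (hτ _).2.symm.trans ((congrArg e h).trans (hτ _).2)
  exact (Equiv.injective _) (Prod.mk.inj this).2

theorem ExitsInOrder.eq {V : Type*} {d N : ℕ} {δ : V → Fin d → V} {e : ℕ → V × Fin d}
    (he : IsEulerCircuit δ N e) {π π' : V → Equiv.Perm (Fin d)} (hπ : ExitsInOrder N e π)
    (hπ' : ExitsInOrder N e π') : π = π' := by
  choose τ hτ hτu using he.existsUnique
  have hanti : ∀ {ρ : V → Equiv.Perm (Fin d)}, ExitsInOrder N e ρ →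
      ∀ v, Antitone ((fun a => τ (v, a)) ∘ ρ v) := fun hρ v =>
    StrictAnti.antitone fun a b hab => hρ v a b _ _ hab (hτ _).1 (hτ _).1 (hτ _).2 (hτ _).2
  funext v
  ext1 a
  have h := congrFun (Tuple.unique_antitone (hanti hπ v) (hanti hπ' v)) a
  exact (Prod.mk.inj ((hτ _).2.symm.trans ((congrArg e h).trans (hτ _).2))).2

theorem IsEulerCircuit.exists_iterate_eq {V : Type*} {d N : ℕ} {δ : V → Fin (d + 1) → V}
    {e : ℕ → V × Fin (d + 1)} (he : IsEulerCircuit δ N e) {π : V → Equiv.Perm (Fin (d + 1))}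
    (hπ : ExitsInOrder N e π) (v : V) : ∃ n, (fun u => δ u (π u 0))^[n] v = (e 0).1 := by
  have key : ∀ k i, i < N → N - i = k →
      ∃ n, (fun u => δ u (π u 0))^[n] (e i).1 = (e 0).1 := by
    intro k
    induction k using Nat.strong_induction_on with
    | _ k ih =>
      intro i hi hk
      obtain ⟨j, ⟨hj, hej⟩, -⟩ := he.existsUnique ((e i).1, π (e i).1 0)
      have hij : i ≤ j := by
        have hei : e i = ((e i).1, π (e i).1 ((π (e i).1).symm (e i).2)) := by simp
        rcases (Fin.zero_le ((π (e i).1).symm (e i).2)).eq_or_lt with h | h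
        · rw [← h] at hei
          exact ((he.existsUnique _).unique ⟨hi, hei⟩ ⟨hj, hej⟩).le
        · exact (hπ _ _ _ _ _ h hj hi hej hei).le
      have hnext : δ (e i).1 (π (e i).1 0) = (e (j + 1)).1 := by rw [← he.chain, hej]
      rcases Nat.lt_or_ge (j + 1) N with h | h
      · obtain ⟨n, hn⟩ := ih (N - (j + 1)) (by omega) (j + 1) h rfl
        exact ⟨n + 1, by rw [Function.iterate_succ_apply, hnext, hn]⟩
      · have hN : j + 1 = 0 + N := by omega
        exact ⟨1, by rw [Function.iterate_one, hnext, hN, he.periodic]⟩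
  obtain ⟨i, ⟨hi, hei⟩, -⟩ := he.existsUnique (v, 0)
  have := key _ i hi rfl
  rwa [hei] at this

theorem ncard_isEulerCircuit_eq {V : Type*} [Fintype V] [DecidableEq V] [Nonempty V] {d : ℕ}
    (δ : V → Fin (d + 1) → V) (hin : ∀ w, #{p : V × Fin (d + 1) | δ p.1 p.2 = w} = d + 1) :
    {e | IsEulerCircuit δ (Fintype.card V * (d + 1)) e}.ncard =
      {p : V × (V → Equiv.Perm (Fin (d + 1))) |
        ∀ v, ∃ n, (fun u => δ u (p.2 u 0))^[n] v = p.1}.ncard := by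
  have hN : 0 < Fintype.card V * (d + 1) := by positivity
  refine Set.ncard_congr
    (fun e he => ((e 0).1, (IsEulerCircuit.exists_exitsInOrder he).choose)) ?_ ?_ ?_
  · intro e he
    exact he.exists_iterate_eq he.exists_exitsInOrder.choose_spec
  · intro e e' he he' h
    have h2 := (Prod.mk.inj h).2
    refine he.eq_of_exitsInOrder hN he' (Prod.mk.inj h).1 he.exists_exitsInOrder.choose_spec ?_
    rw [h2]
    exact he'.exists_exitsInOrder.choose_spec
  · rintro ⟨r, π⟩ hp
    obtain ⟨e, he, h0, hπ⟩ := exists_isEulerCircuit δ hin r π hp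
    exact ⟨e, he, Prod.ext h0 (ExitsInOrder.eq he he.exists_exitsInOrder.choose_spec hπ)⟩

theorem card_perms_apply_zero {V : Type*} [Fintype V] {d : ℕ} (P : (V → Fin (d + 1)) → Prop) :
    Nat.card {π : V → Equiv.Perm (Fin (d + 1)) // P fun v => π v 0} =
      Nat.card {f // P f} * d.factorial ^ Fintype.card V := by
  classical
  let E : (V → Equiv.Perm (Fin (d + 1))) ≃ (V → Fin (d + 1)) × (V → Equiv.Perm (Fin d)) :=
    (Equiv.piCongrRight fun _ => Equiv.Perm.decomposeFin).trans
      (Equiv.arrowProdEquivProdArrow _ _ _)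
  have hE : ∀ π v, (E π).1 v = π v 0 := by
    intro π v
    refine (Equiv.Perm.decomposeFin_symm_apply_zero (Equiv.Perm.decomposeFin (π v)).1
      (Equiv.Perm.decomposeFin (π v)).2).symm.trans ?_
    rw [Prod.mk.eta, Equiv.symm_apply_apply]
  have e1 : {π : V → Equiv.Perm (Fin (d + 1)) // P fun v => π v 0} ≃
      {q : (V → Fin (d + 1)) × (V → Equiv.Perm (Fin d)) // P q.1} :=
    E.subtypeEquiv fun π => by rw [← funext (hE π)]
  rw [Nat.card_congr (e1.trans Equiv.prodSubtypeFstEquivSubtypeProd), Nat.card_prod]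
  simp [Fintype.card_perm]

/-- Counts closed Eulerian trails with a marked starting edge. -/
theorem ncard_isEulerCircuit {V : Type*} [Fintype V] [DecidableEq V] [Nonempty V] {d m : ℕ}
    (δ : V → Fin (d + 1) → V) (hin : ∀ w, #{p : V × Fin (d + 1) | δ p.1 p.2 = w} = d + 1)
    (hpow : ∀ u v, (transitionMatrix δ ^ m) u = (transitionMatrix δ ^ m) v) :
    {e | IsEulerCircuit δ (Fintype.card V * (d + 1)) e}.ncard =
      (d + 1).factorial ^ Fintype.card V := by
  classical
  set n := Fintype.card V with hn
  have hT := fun r => card_mul_card_reaching δ hin hpow r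
  have hsum : {p : V × (V → Equiv.Perm (Fin (d + 1))) |
        ∀ v, ∃ n, (fun u => δ u (p.2 u 0))^[n] v = p.1}.ncard =
      ∑ r, Nat.card {f : V → Fin (d + 1) // ∀ v, ∃ n, (fun u => δ u (f u))^[n] v = r} *
        d.factorial ^ n := by
    rw [Set.ncard_eq_toFinset_card', Set.toFinset_ofPred, Finset.card_filter,
      Fintype.sum_prod_type]
    refine Finset.sum_congr rfl fun r _ => ?_
    rw [← card_perms_apply_zero fun f => ∀ v, ∃ n, (fun u => δ u (f u))^[n] v = r,
      Nat.card_eq_fintype_card, Fintype.card_subtype, Finset.card_filter]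
  rw [ncard_isEulerCircuit_eq δ hin, hsum]
  have hpos : 0 < n := Fintype.card_pos
  apply Nat.eq_of_mul_eq_mul_left hpos
  rw [Finset.mul_sum]
  simp_rw [← mul_assoc, hn, hT]
  rw [Finset.sum_const, Finset.card_univ, smul_eq_mul, Nat.factorial_succ, mul_pow]

/-- The successor function of the de Bruijn graph: append a letter to a word and drop the first
letter of the result. -/
def shiftAppend {σ m : ℕ} (v : Fin m → Fin σ) (a : Fin σ) : Fin m → Fin σ :=
  Fin.tail (Fin.snoc v a : Fin (m + 1) → Fin σ)

theorem card_shiftAppend_eq {σ m : ℕ} (w : Fin m → Fin σ) :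
    #{p : (Fin m → Fin σ) × Fin σ | shiftAppend p.1 p.2 = w} = σ := by
  conv_rhs => rw [← Finset.card_fin σ]
  refine Finset.card_nbij' (fun p => (Fin.snoc p.1 p.2 : Fin (m + 1) → Fin σ) 0)
    (fun b => (Fin.init (Fin.cons b w : Fin (m + 1) → Fin σ),
      (Fin.cons b w : Fin (m + 1) → Fin σ) (Fin.last m))) ?_ ?_ ?_ ?_
  · intro p _
    simp
  · intro b _
    refine Finset.mem_coe.mpr (Finset.mem_filter.mpr ⟨Finset.mem_univ _, ?_⟩)
    simp [shiftAppend, Fin.snoc_init_self]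
  · rintro ⟨v, a⟩ h
    have h : Fin.tail (Fin.snoc v a : Fin (m + 1) → Fin σ) = w :=
      (Finset.mem_filter.mp (Finset.mem_coe.mp h)).2
    have hc := Fin.cons_self_tail (Fin.snoc v a : Fin (m + 1) → Fin σ)
    rw [h] at hc
    simp [hc]
  · intro b _
    simp [Fin.snoc_init_self]

theorem transitionMatrix_shiftAppend_pow {σ m : ℕ} (u v : Fin m → Fin σ) :
    (transitionMatrix (shiftAppend (σ := σ) (m := m)) ^ m) u =
      (transitionMatrix (shiftAppend (σ := σ) (m := m)) ^ m) v := by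
  have key : ∀ (j : ℕ) (u v : Fin m → Fin σ), (∀ i : Fin m, j ≤ i → u i = v i) →
      (transitionMatrix (shiftAppend (σ := σ) (m := m)) ^ j) u =
        (transitionMatrix (shiftAppend (σ := σ) (m := m)) ^ j) v := by
    intro j
    induction j with
    | zero =>
      intro u v h
      rw [funext fun i => h i (Nat.zero_le _)]
    | succ j ih =>
      intro u v h
      have hmul : ∀ (M : Matrix (Fin m → Fin σ) (Fin m → Fin σ) ℚ) u,
          (transitionMatrix (shiftAppend (σ := σ) (m := m)) * M) u =
            ∑ a, M (shiftAppend u a) := by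
        intro M u
        ext w
        simp only [Matrix.mul_apply, transitionMatrix, Matrix.of_apply, Finset.sum_apply,
          Finset.sum_mul]
        rw [Finset.sum_comm]
        simp [Pi.single_apply]
      rw [pow_succ', hmul, hmul]
      refine Finset.sum_congr rfl fun a _ => ih _ _ fun i hi => ?_
      simp only [shiftAppend, Fin.tail, Fin.snoc, Fin.val_succ]
      split_ifs with hlt
      · exact h _ (Nat.succ_le_succ hi)
      · rfl
  exact key m u v fun i hi => absurd i.2 (not_lt.mpr hi)

theorem take_drop_append_self {α : Type*} {s : List α} {x : ℕ → α} {k i : ℕ}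
    (hx : ∀ j (hj : j < s.length), x j = s[j]) (hper : ∀ j, x (j + s.length) = x j)
    (hk : k ≤ s.length) (hi : i < s.length) :
    ((s ++ s).drop i).take k = List.ofFn fun j : Fin k => x (i + j) := by
  apply List.ext_getElem
  · simp; omega
  · intro j h1 h2
    simp only [List.length_ofFn] at h2
    simp only [List.getElem_take, List.getElem_drop, List.getElem_ofFn, List.getElem_append]
    split_ifs with h
    · rw [hx]
    · rw [← hx, ← hper]
      congr 1
      omega

/-- `x` is `N`-periodic and every word of length `k` occurs in it exactly once per period. -/
def IsDeBruijnFun {α : Type*} (k N : ℕ) (x : ℕ → α) : Prop :=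
  (∀ i, x (i + N) = x i) ∧ ∀ w : Fin k → α, ∃! i, i < N ∧ (fun j : Fin k => x (i + j)) = w

theorem isDeBruijn_iff_isDeBruijnFun {σ k : ℕ} {s : List (Fin σ)} {x : ℕ → Fin σ}
    (hlen : s.length = σ ^ k) (hk : k ≤ σ ^ k)
    (hx : ∀ j (hj : j < s.length), x j = s[j]) (hper : ∀ j, x (j + s.length) = x j) :
    IsDeBruijn σ k s ↔ IsDeBruijnFun k (σ ^ k) x := by
  have hwin : ∀ (w : Fin k → Fin σ) i,
      (i < s.length ∧ ((s ++ s).drop i).take k = List.ofFn w) ↔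
        (i < σ ^ k ∧ (fun j : Fin k => x (i + j)) = w) := by
    intro w i
    rw [← hlen]
    refine and_congr_right fun hi => ?_
    rw [take_drop_append_self hx hper (hlen ▸ hk) hi, List.ofFn_inj]
  constructor
  · intro hs
    refine ⟨hlen ▸ hper, fun w => ?_⟩
    simpa only [hwin] using hs.2 (List.ofFn w) (List.length_ofFn)
  · intro hs
    refine ⟨hlen, fun w hw => ?_⟩
    subst hw
    have := hs.2 w.get
    simp only [← hwin] at this
    simpa only [List.ofFn_get] using this

theorem ncard_isDeBruijn_eq {σ k : ℕ} (hσ : 2 ≤ σ) :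
    {s | IsDeBruijn σ k s}.ncard = {x : ℕ → Fin σ | IsDeBruijnFun k (σ ^ k) x}.ncard := by
  have hk : k ≤ σ ^ k := (Nat.lt_pow_self hσ).le
  have hpos : 0 < σ ^ k := by positivity
  symm
  refine Set.ncard_congr (fun x _ => List.ofFn fun i : Fin (σ ^ k) => x i) ?_ ?_ ?_
  · intro x hx
    refine (isDeBruijn_iff_isDeBruijnFun (x := x) (by simp) hk (by simp) ?_).mpr hx
    simpa using hx.1
  · intro x y hx hy h
    have h := List.ofFn_injective h
    funext i
    rw [← Function.Periodic.map_mod_nat hx.1, ← Function.Periodic.map_mod_nat hy.1]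
    exact congrFun h ⟨_, Nat.mod_lt i hpos⟩
  · intro s hs
    have hlen : s.length = σ ^ k := hs.1
    have hmod : ∀ i, i % s.length < s.length := fun i => Nat.mod_lt i (hlen ▸ hpos)
    refine ⟨fun i => s[i % s.length]'(hmod i),
      (isDeBruijn_iff_isDeBruijnFun (x := fun i => s[i % s.length]'(hmod i)) hlen hk
        (fun j hj => ?_) fun j => ?_).mp hs, ?_⟩
    · simp [Nat.mod_eq_of_lt hj]
    · simp
    · apply List.ext_getElem
      · simp [hlen]
      · intro i h1 h2
        simp [Nat.mod_eq_of_lt h2]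

theorem ncard_isDeBruijnFun_eq {σ m N : ℕ} :
    {x : ℕ → Fin σ | IsDeBruijnFun (m + 1) N x}.ncard =
      {e | IsEulerCircuit (shiftAppend (σ := σ) (m := m)) N e}.ncard := by
  have hsnoc : ∀ (x : ℕ → Fin σ) i, (Fin.snoc (fun j : Fin m => x (i + j)) (x (i + m)) :
      Fin (m + 1) → Fin σ) = fun j : Fin (m + 1) => x (i + j) := by
    intro x i
    funext j
    refine Fin.lastCases ?_ (fun j => ?_) j <;> simp
  have hedge : ∀ (x : ℕ → Fin σ) i (p : (Fin m → Fin σ) × Fin σ),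
      (fun j : Fin m => x (i + j), x (i + m)) = p ↔
        (fun j : Fin (m + 1) => x (i + j)) = Fin.snoc p.1 p.2 := by
    rintro x i ⟨v, a⟩
    rw [← hsnoc, Prod.mk.injEq, Fin.snoc_inj]
  have hsnoc_split : ∀ w : Fin (m + 1) → Fin σ, w = Fin.snoc (Fin.init w) (w (Fin.last m)) :=
    fun w => (Fin.snoc_init_self w).symm
  refine Set.ncard_congr (fun x _ i => (fun j : Fin m => x (i + j), x (i + m))) ?_ ?_ ?_
  · intro x hx
    refine ⟨fun i => ?_, fun i => ?_, fun p => ?_⟩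
    · simp only [add_right_comm i N, hx.1]
    · simp only [shiftAppend, hsnoc]
      funext j
      simp [Fin.tail, add_assoc, add_comm 1]
    · simp only [hedge]
      exact hx.2 _
  · intro x y _ _ h
    funext i
    have h1 := (hedge x i _).mp (congrFun h i)
    rw [hsnoc] at h1
    simpa using congrFun h1 0
  · intro e he
    set W : ℕ → Fin (m + 1) → Fin σ := fun i => Fin.snoc (e i).1 (e i).2 with hW
    have hstep : ∀ i (j : Fin m), W i j.succ = W (i + 1) j.castSucc := by
      intro i j
      have := congrFun (he.chain i) j
      simpa [hW, shiftAppend, Fin.tail] using this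
    have hWx : ∀ (n : ℕ) (hn : n < m + 1) i, W i ⟨n, hn⟩ = W (i + n) 0 := by
      intro n
      induction n with
      | zero => intro _ i; rfl
      | succ n ih =>
        intro hn i
        have h1 := ih (by omega) (i + 1)
        rw [add_assoc, add_comm 1 n] at h1
        rw [← h1]
        exact hstep i ⟨n, by omega⟩
    have hex : (fun i => ((fun j : Fin m => W (i + j) 0 : Fin m → Fin σ), W (i + m) 0)) = e := by
      funext i
      rw [hedge (fun i => W i 0)]
      funext j
      exact (hWx j j.2 i).symm
    refine ⟨fun i => W i 0, ⟨fun i => by simp only [hW, he.periodic], fun w => ?_⟩, hex⟩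
    have := he.existsUnique (Fin.init w, w (Fin.last m))
    rw [← hex] at this
    simp only [hedge (fun i => W i 0)] at this
    rwa [← hsnoc_split w] at this

/-- Rosenfeld/de Bruijn: the number of σ-ary de Bruijn sequences of order k
is (σ!)^(σ^(k-1)). -/
theorem stmt_0 (σ k : ℕ) (hσ : 2 ≤ σ) (hk : 1 ≤ k) :
    {s : List (Fin σ) | IsDeBruijn σ k s}.ncard =
      (Nat.factorial σ) ^ (σ ^ (k - 1)) := by
  obtain ⟨m, rfl⟩ := Nat.exists_eq_add_of_le' hk
  obtain ⟨d, rfl⟩ := Nat.exists_eq_add_of_le' (show 1 ≤ σ by omega)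
  rw [ncard_isDeBruijn_eq hσ, ncard_isDeBruijnFun_eq]
  have h := ncard_isEulerCircuit (shiftAppend (σ := d + 1) (m := m)) card_shiftAppend_eq
    transitionMatrix_shiftAppend_pow
  simpa [pow_succ] using h
end

section
/- Fix σ ≥ 2, constants 1 ≥ c ≥ 0 and ε > 0. For each sufficiently large n, let k = ⌈(c + ε/2)·log_σ n⌉. Then any deterministic one-pass algorithm using at most O(n^c) bits of memory must, on some string s of length n with H_k(s) = 0 (a repetition of a truncated de Bruijn sequence of order k), output Ω(n) bits; in particular it cannot encode every length-n string in O(n·H_k(s) + σ^k·n^(1-c-ε)) bits. -/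
/-- characters immediately following occurrences of context `w` in `s` -/
def follow {α : Type*} [DecidableEq α] (s w : List α) : List α :=
  s.tails.filterMap (fun t => if t.take w.length = w then (t.drop w.length).head? else none)

/-- zeroth-order empirical entropy (base 2), with the convention 0·log(·)=0 -/
noncomputable def H0 {σ : ℕ} (t : List (Fin σ)) : ℝ :=
  ∑ a : Fin σ, ((t.count a : ℝ) / t.length) * Real.logb 2 ((t.length : ℝ) / t.count a)

/-- `|s| · H_k(s)`: sum over all contexts `w` of length `k` of `|s_w| · H_0(s_w)` -/
noncomputable def nHk {σ : ℕ} (s : List (Fin σ)) (k : ℕ) : ℝ :=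
  ∑ w : Fin k → Fin σ,
    ((follow s (List.ofFn w)).length : ℝ) * H0 (follow s (List.ofFn w))

/-- `k`-th order empirical entropy -/
noncomputable def Hk {σ : ℕ} (s : List (Fin σ)) (k : ℕ) : ℝ := nHk s k / s.length

/-- state reached by a deterministic transducer after reading a string -/
def stRun {Q α : Type*} (δ : Q → α → Q × List Bool) : Q → List α → Q
  | q, [] => q
  | q, a :: t => stRun δ (δ q a).1 t

/-- bits output by a deterministic transducer while reading a string -/
def outRun {Q α : Type*} (δ : Q → α → Q × List Bool) : Q → List α → List Bool
  | _, [] => []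
  | q, a :: t => (δ q a).2 ++ outRun δ (δ q a).1 t

/-- A word with no occurrence of the run `z ^ K` and no two equal windows of length `k`. -/
def IsSync {α : Type*} (z : α) (K k : ℕ) (w : List α) : Prop :=
  (∀ p, p + K ≤ w.length → ∃ t < K, w[p + t]? ≠ some z) ∧
    ∀ p q, p < q → q + k ≤ w.length → ∃ t < k, w[p + t]? ≠ w[q + t]?

/-- The words of length `j` satisfying `IsSync`. -/
def syncWords {α : Type*} (z : α) (K k j : ℕ) : Set (List α) :=
  {w | w.length = j ∧ IsSync z K k w}

theorem IsSync.drop {α : Type*} {z : α} {K k : ℕ} {w : List α} (h : IsSync z K k w) (m : ℕ) :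
    IsSync z K k (w.drop m) := by
  refine ⟨fun p hp => ?_, fun p q hpq hq => ?_⟩
  · rcases Nat.lt_or_ge w.length m with hm | hm
    · have : K = 0 := by simp at hp; omega
      have := h.1 0 (by omega)
      simp_all
    · obtain ⟨t, ht, h'⟩ := h.1 (m + p) (by simp at hp; omega)
      exact ⟨t, ht, by rwa [List.getElem?_drop, ← add_assoc]⟩
  · obtain ⟨t, ht, h'⟩ := h.2 (m + p) (m + q) (by omega) (by simp at hq; omega)
    exact ⟨t, ht, by rwa [List.getElem?_drop, List.getElem?_drop, ← add_assoc, ← add_assoc]⟩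

theorem finite_lists_length {α : Type*} [Finite α] (P : List α → Prop) (j : ℕ) :
    {w : List α | w.length = j ∧ P w}.Finite :=
  (List.finite_length_eq α j).subset fun _ h => h.1

theorem ncard_extensions {α : Type*} [Fintype α] (P : List α → Prop) (j : ℕ) :
    {u : List α | u.length = j + 1 ∧ P (u.drop 1)}.ncard
      = Fintype.card α * {w : List α | w.length = j ∧ P w}.ncard := by
  have : {u : List α | u.length = j + 1 ∧ P (u.drop 1)}
      = Set.image (fun x : α × List α => x.1 :: x.2)
        (Set.univ ×ˢ {w : List α | w.length = j ∧ P w}) := by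
    ext u
    cases u <;> simp
  rw [this, Set.ncard_image_of_injective, Set.ncard_prod, Set.ncard_univ, Nat.card_eq_fintype_card]
  rintro ⟨a, u⟩ ⟨b, v⟩ h
  simpa using h

theorem ncard_le_syncWords {α : Type*} [Finite α] {z : α} {K k j m : ℕ} (hm : 1 ≤ m)
    {T : Set (List α)} (hT : ∀ u ∈ T, u.length = j + 1 ∧ IsSync z K k (u.drop 1))
    (hinj : Set.InjOn (List.drop m) T) : T.ncard ≤ (syncWords z K k (j + 1 - m)).ncard := by
  refine Set.ncard_le_ncard_of_injOn _ (fun u hu => ?_) hinj (finite_lists_length _ _)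
  obtain ⟨h1, h2⟩ := hT u hu
  refine ⟨by simp [h1], ?_⟩
  have := h2.drop (m - 1)
  rwa [List.drop_drop, show 1 + (m - 1) = m by omega] at this

theorem eq_of_drop_eq_of_getElem? {α : Type*} {m p : ℕ} (hp : 1 ≤ p) {u v : List α}
    (hu : ∀ t < m, u[t]? = u[p + t]?) (hv : ∀ t < m, v[t]? = v[p + t]?)
    (h : u.drop m = v.drop m) : u = v := by
  have key : ∀ s t, m ≤ t + s → u[t]? = v[t]? := by
    intro s
    induction s with
    | zero =>
      intro t ht
      have := congrArg (fun l : List α => l[t - m]?) h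
      simpa [List.getElem?_drop, show m + (t - m) = t by omega] using this
    | succ s ih =>
      intro t ht
      by_cases htm : t < m
      · rw [hu t htm, hv t htm]
        exact ih _ (by omega)
      · exact ih _ (by omega)
  exact List.ext_getElem? fun t => key m t (by omega)

theorem mul_ncard_syncWords_le {α : Type*} [Fintype α] (z : α) {K k L : ℕ} (hK : 1 ≤ K)
    (hk : 1 ≤ k) {β : ℝ} (hβ : 0 < β)
    (hrate : 1 / β ^ (K - 1) + L / β ^ (k - 1) + β ≤ Fintype.card α) (j : ℕ) (hj : j < L) :
    β * (syncWords z K k j).ncard ≤ (syncWords z K k (j + 1)).ncard := by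
  induction j using Nat.strong_induction_on with
  | _ j ih =>
  set S : ℕ → ℕ := fun i => (syncWords z K k i).ncard with hS
  have hpow : ∀ m ≤ j, β ^ m * S (j - m) ≤ S j := by
    intro m
    induction m with
    | zero => simp
    | succ m ihm =>
      intro hm
      have h1 := ih (j - (m + 1)) (by omega) (by omega)
      rw [show j - (m + 1) + 1 = j - m by omega] at h1
      refine le_trans ?_ (ihm (by omega))
      rw [pow_succ, mul_assoc]
      gcongr
  have hbad : ∀ m, 1 ≤ m → ∀ T : Set (List α),
      (∀ u ∈ T, u.length = j + 1 ∧ IsSync z K k (u.drop 1)) → (∀ u ∈ T, m ≤ j + 1) →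
      Set.InjOn (List.drop m) T → (T.ncard : ℝ) ≤ S j / β ^ (m - 1) := by
    intro m hm T hT hle hinj
    rcases T.eq_empty_or_nonempty with rfl | ⟨u, hu⟩
    · simp; positivity
    · have h1 : (T.ncard : ℝ) ≤ S (j + 1 - m) := by
        exact_mod_cast ncard_le_syncWords hm hT hinj
      have h2 := hpow (m - 1) (by have := hle u hu; omega)
      rw [show j - (m - 1) = j + 1 - m by omega] at h2
      rw [le_div_iff₀ (by positivity), mul_comm]
      exact le_trans (by gcongr) h2
  set T0 : Set (List α) := {u | (u.length = j + 1 ∧ IsSync z K k (u.drop 1)) ∧ K ≤ j + 1 ∧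
    ∀ t < K, u[t]? = some z} with hT0
  set T : ℕ → Set (List α) := fun p => {u | (u.length = j + 1 ∧ IsSync z K k (u.drop 1)) ∧
    k ≤ j + 1 ∧ ∀ t < k, u[t]? = u[p + 1 + t]?} with hTdef
  have h0 : (T0.ncard : ℝ) ≤ S j / β ^ (K - 1) := by
    refine hbad K hK _ (fun u hu => hu.1) (fun u hu => hu.2.1) ?_
    intro u hu v hv huv
    refine List.ext_getElem? fun t => ?_
    by_cases ht : t < K
    · rw [hu.2.2 t ht, hv.2.2 t ht]
    · have := congrArg (fun l : List α => l[t - K]?) huv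
      simpa [List.getElem?_drop, show K + (t - K) = t by omega] using this
  have h1 : ∀ p, ((T p).ncard : ℝ) ≤ S j / β ^ (k - 1) := by
    intro p
    refine hbad k hk _ (fun u hu => hu.1) (fun u hu => hu.2.1) ?_
    intro u hu v hv huv
    exact eq_of_drop_eq_of_getElem? (by omega) hu.2.2 hv.2.2 huv
  have hsub : {u : List α | u.length = j + 1 ∧ IsSync z K k (u.drop 1)} ⊆
      (syncWords z K k (j + 1) ∪ T0) ∪ ⋃ p ∈ Finset.range j, T p := by
    intro u hu
    by_contra hcon
    simp only [Set.mem_union, Set.mem_iUnion, not_or, not_exists] at hcon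
    obtain ⟨⟨hn, hn0⟩, hn1⟩ := hcon
    refine hn ⟨hu.1, ?_, ?_⟩
    · intro p hp
      rcases p with _ | p
      · by_contra! hc
        exact hn0 ⟨hu, by have := hu.1; omega, by simpa using hc⟩
      · obtain ⟨t, ht, h⟩ := hu.2.1 p (by simp; omega)
        exact ⟨t, ht, by rwa [List.getElem?_drop, show 1 + (p + t) = p + 1 + t by omega] at h⟩
    · intro p q hpq hq
      obtain ⟨q, rfl⟩ : ∃ q', q = q' + 1 := ⟨q - 1, by omega⟩
      rcases p with _ | p
      · by_contra! hc
        have := hu.1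
        exact hn1 q (by simp; omega) ⟨hu, by omega, by simpa using hc⟩
      · obtain ⟨t, ht, h⟩ := hu.2.2 p q (by omega) (by simp; omega)
        refine ⟨t, ht, ?_⟩
        rwa [List.getElem?_drop, List.getElem?_drop, show 1 + (p + t) = p + 1 + t by omega,
          show 1 + (q + t) = q + 1 + t by omega] at h
  have hfin : ((syncWords z K k (j + 1) ∪ T0) ∪ ⋃ p ∈ Finset.range j, T p).Finite :=
    (List.finite_length_eq α (j + 1)).subset (by
      rintro u ((hu | hu) | hu)
      · exact hu.1
      · exact hu.1.1
      · simp only [Set.mem_iUnion] at hu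
        obtain ⟨p, -, hu⟩ := hu
        exact hu.1.1)
  have hcard : Fintype.card α * S j ≤ S (j + 1) + T0.ncard + ∑ p ∈ Finset.range j, (T p).ncard := by
    rw [hS]
    simp only [syncWords]
    rw [← ncard_extensions]
    refine (Set.ncard_le_ncard hsub hfin).trans ((Set.ncard_union_le _ _).trans ?_)
    gcongr
    · exact Set.ncard_union_le _ _
    · exact Finset.set_ncard_biUnion_le _ _
  have hcard' : (Fintype.card α : ℝ) * S j ≤
      S (j + 1) + T0.ncard + ∑ p ∈ Finset.range j, ((T p).ncard : ℝ) := by exact_mod_cast hcard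
  have hsum : ∑ p ∈ Finset.range j, ((T p).ncard : ℝ) ≤ L * (S j / β ^ (k - 1)) := by
    refine (Finset.sum_le_sum fun p _ => h1 p).trans ?_
    rw [Finset.sum_const, Finset.card_range, nsmul_eq_mul]
    gcongr
  have := mul_le_mul_of_nonneg_right hrate (Nat.cast_nonneg (α := ℝ) (S j))
  have e : (1 / β ^ (K - 1) + L / β ^ (k - 1) + β) * (S j : ℝ)
      = S j / β ^ (K - 1) + L * (S j / β ^ (k - 1)) + β * S j := by ring
  linarith

theorem pow_le_ncard_syncWords {α : Type*} [Fintype α] (z : α) {K k L : ℕ} (hK : 1 ≤ K)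
    (hk : 1 ≤ k) {β : ℝ} (hβ : 0 < β)
    (hrate : 1 / β ^ (K - 1) + L / β ^ (k - 1) + β ≤ Fintype.card α) (j : ℕ) (hj : j ≤ L) :
    β ^ j ≤ (syncWords z K k j).ncard := by
  induction j with
  | zero =>
    have : syncWords z K k 0 = {[]} := by
      ext w
      simp only [syncWords, List.length_eq_zero_iff, Set.mem_ofPred_eq, Set.mem_singleton_iff,
        and_iff_left_iff_imp]
      rintro rfl
      exact ⟨fun p hp => by simp at hp; omega, fun p q hpq hq => by simp at hq; omega⟩
    simp [this]
  | succ j ih =>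
    refine le_trans ?_ (mul_ncard_syncWords_le z hK hk hβ hrate j (by omega))
    rw [pow_succ, mul_comm]
    gcongr
    exact ih (by omega)

theorem H0_eq_zero_of_forall_eq {σ : ℕ} (t : List (Fin σ)) (h : ∀ a ∈ t, ∀ b ∈ t, a = b) :
    H0 t = 0 := by
  refine Finset.sum_eq_zero fun a _ => ?_
  by_cases ha : a ∈ t
  · rw [List.count_eq_length.2 fun b hb => h a ha b hb]
    by_cases h0 : (t.length : ℝ) = 0
    · simp [h0]
    · simp [div_self h0]
  · simp [List.count_eq_zero_of_not_mem ha]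

theorem exists_of_mem_follow {α : Type*} [DecidableEq α] {s w : List α} {a : α}
    (h : a ∈ follow s w) :
    ∃ i, s[i + w.length]? = some a ∧ ∀ t < w.length, s[i + t]? = w[t]? := by
  simp only [follow, List.mem_filterMap, List.mem_tails] at h
  obtain ⟨u, hu, hua⟩ := h
  obtain ⟨p, rfl⟩ := hu
  split_ifs at hua with hw
  refine ⟨p.length, ?_, fun t ht => ?_⟩
  · rw [List.getElem?_append_right (by omega)]
    simpa [List.head?_drop] using hua
  · rw [List.getElem?_append_right (by omega), Nat.add_sub_cancel_left]
    conv_rhs => rw [← hw]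
    rw [List.getElem?_take_of_lt ht]

theorem Hk_map_range_eq_zero {σ : ℕ} (f : ℕ → Fin σ) (k n : ℕ)
    (hf : ∀ i j, (∀ t < k, f (i + t) = f (j + t)) → f (i + k) = f (j + k)) :
    Hk ((List.range n).map f) k = 0 := by
  have key : nHk ((List.range n).map f) k = 0 := by
    refine Finset.sum_eq_zero fun w _ => ?_
    rw [H0_eq_zero_of_forall_eq, mul_zero]
    intro a ha b hb
    obtain ⟨i, hia, hi⟩ := exists_of_mem_follow ha
    obtain ⟨j, hjb, hj⟩ := exists_of_mem_follow hb
    simp only [List.length_ofFn] at hia hi hjb hj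
    have hin : i + k < n := by
      have := (List.getElem?_eq_some_iff.1 hia).1
      simpa using this
    have hjn : j + k < n := by
      have := (List.getElem?_eq_some_iff.1 hjb).1
      simpa using this
    rw [List.getElem?_map, List.getElem?_range hin] at hia
    rw [List.getElem?_map, List.getElem?_range hjn] at hjb
    simp only [Option.map_some, Option.some.injEq] at hia hjb
    rw [← hia, ← hjb]
    refine hf i j fun t ht => ?_
    have := (hi t ht).trans (hj t ht).symm
    rw [List.getElem?_map, List.getElem?_map, List.getElem?_range (by omega),
      List.getElem?_range (by omega)] at this
    simpa using this
  rw [Hk, key, zero_div]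

/-- The periodic sequence with period the word `z ^ K o w o`. -/
def markedSeq {α : Type*} (z o : α) (K : ℕ) (w : List α) (i : ℕ) : α :=
  (List.replicate K z ++ o :: (w ++ [o])).getD (i % (K + w.length + 2)) z

section MarkedSeq

variable {α : Type*} {z o : α} {K : ℕ} {w : List α}

theorem markedSeq_mod (i : ℕ) :
    markedSeq z o K w (i % (K + w.length + 2)) = markedSeq z o K w i := by
  simp [markedSeq]

theorem markedSeq_left {i : ℕ} (hi : i = K) : markedSeq z o K w i = o := by
  subst hi
  rw [markedSeq, Nat.mod_eq_of_lt (by omega)]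
  simp

theorem markedSeq_right {i : ℕ} (hi : i = K + w.length + 1) : markedSeq z o K w i = o := by
  subst hi
  rw [markedSeq, Nat.mod_eq_of_lt (by omega), List.getD_eq_getElem?_getD,
    List.getElem?_append_right (by simp; omega)]
  simp [show K + w.length + 1 - K = w.length + 1 by omega]

theorem some_markedSeq {i : ℕ} (hi : i < w.length) :
    some (markedSeq z o K w (K + 1 + i)) = w[i]? := by
  rw [markedSeq, Nat.mod_eq_of_lt (by omega), List.getD_eq_getElem?_getD,
    List.getElem?_append_right (by simp; omega)]
  simp [show K + 1 + i - K = i + 1 by omega, List.getElem?_append_left hi, hi]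

theorem mod_eq_zero_of_run {k : ℕ} (hzo : z ≠ o) (hw : IsSync z K k w) {p : ℕ}
    (h : ∀ t < K, markedSeq z o K w (p + t) = z) (hK : 1 ≤ K) :
    p % (K + w.length + 2) = 0 := by
  set L := K + w.length + 2 with hL
  set r := p % L with hr
  have hrL : r < L := Nat.mod_lt _ (by omega)
  have h' : ∀ t < K, markedSeq z o K w (r + t) = z := by
    intro t ht
    refine Eq.trans ?_ (h t ht)
    rw [← markedSeq_mod, ← markedSeq_mod (p + t), ← hL, hr, Nat.mod_add_mod]
  by_contra hne
  rcases Nat.lt_or_ge K r with h1 | h1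
  · rcases Nat.lt_or_ge (r + K) L with h2 | h2
    · obtain ⟨t, ht, hne'⟩ := hw.1 (r - K - 1) (by omega)
      apply hne'
      rw [← some_markedSeq (z := z) (o := o) (K := K) (by omega)]
      refine congrArg some (Eq.trans ?_ (h' t ht))
      congr 1
      omega
    · have := h' (L - 1 - r) (by omega)
      rw [markedSeq_right (by omega)] at this
      exact hzo this.symm
  · have := h' (K - r) (by omega)
    rw [markedSeq_left (by omega)] at this
    exact hzo this.symm

theorem mod_eq_of_window {k m : ℕ} (hzo : z ≠ o) (hw : IsSync z K k w) (hK : 1 ≤ K)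
    (hm : k + 2 * K ≤ m) {i j : ℕ}
    (h : ∀ t < m, markedSeq z o K w (i + t) = markedSeq z o K w (j + t)) :
    i % (K + w.length + 2) = j % (K + w.length + 2) := by
  set L := K + w.length + 2 with hL
  by_cases hrun : ∃ t, t + K ≤ m ∧ ∀ s < K, markedSeq z o K w (i + t + s) = z
  · obtain ⟨t, ht, hs⟩ := hrun
    have hs' : ∀ s < K, markedSeq z o K w (j + t + s) = z := fun s hsK => by
      rw [add_assoc, ← h (t + s) (by omega), ← add_assoc, hs s hsK]
    have e1 := mod_eq_zero_of_run hzo hw hs hK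
    have e2 := mod_eq_zero_of_run hzo hw hs' hK
    exact Nat.ModEq.add_right_cancel' t (e1.trans e2.symm)
  · have hpos : ∀ q, (∀ t, t + K ≤ m → ¬ ∀ s < K, markedSeq z o K w (q + t + s) = z) →
        1 ≤ q % L ∧ q % L + (m - K) < L := by
      intro q hq
      have hzero : ∀ t, t + K ≤ m → (q + t) % L ≠ 0 := by
        intro t ht h0
        refine hq t ht fun s hs => ?_
        rw [← markedSeq_mod, ← hL, Nat.add_mod, h0, zero_add, Nat.mod_mod, markedSeq,
          List.getD_eq_getElem?_getD, Nat.mod_mod, Nat.mod_eq_of_lt (by omega),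
          List.getElem?_append_left (by simpa)]
        simp [hs]
      refine ⟨?_, ?_⟩
      · have := hzero 0 (by omega)
        simp only [add_zero] at this
        omega
      · by_contra hge
        have hlt : q % L < L := Nat.mod_lt _ (by omega)
        refine hzero (L - q % L) (by omega) ?_
        rw [Nat.add_mod, Nat.mod_eq_of_lt (a := L - q % L)]
        · rw [show q % L + (L - q % L) = L by omega, Nat.mod_self]
        · by_contra h0
          have := hzero 0 (by omega)
          simp only [add_zero] at this
          omega
    push Not at hrun
    have hi := hpos i (fun t ht hc => by obtain ⟨s, hs, h'⟩ := hrun t ht; exact h' (hc s hs))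
    have hj := hpos j (fun t ht hc => by
      obtain ⟨s, hs, h'⟩ := hrun t ht
      refine h' ?_
      rw [add_assoc, h (t + s) (by omega), ← add_assoc, hc s hs])
    have hmK : k + K ≤ m - K := by omega
    have hwin : ∀ t < k, w[i % L - 1 + t]? = w[j % L - 1 + t]? := by
      intro t ht
      rw [← some_markedSeq (z := z) (o := o) (K := K) (by omega),
        ← some_markedSeq (z := z) (o := o) (K := K) (by omega)]
      have := h (K + t) (by omega)
      rw [← markedSeq_mod, ← markedSeq_mod (j + (K + t)), ← hL, ← Nat.mod_add_mod,
        ← Nat.mod_add_mod j, Nat.mod_eq_of_lt (a := i % L + (K + t)) (by omega),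
        Nat.mod_eq_of_lt (a := j % L + (K + t)) (by omega)] at this
      rw [show K + 1 + (i % L - 1 + t) = i % L + (K + t) by omega,
        show K + 1 + (j % L - 1 + t) = j % L + (K + t) by omega, this]
    rcases lt_trichotomy (i % L) (j % L) with hlt | heq | hlt
    · obtain ⟨t, ht, h'⟩ := hw.2 (i % L - 1) (j % L - 1) (by omega) (by omega)
      exact absurd (hwin t ht) h'
    · exact heq
    · obtain ⟨t, ht, h'⟩ := hw.2 (j % L - 1) (i % L - 1) (by omega) (by omega)
      exact absurd (hwin t ht).symm h'

theorem map_markedSeq_injOn (z o : α) (K j : ℕ) :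
    Set.InjOn (fun w => (List.range (K + j + 2)).map (markedSeq z o K w))
      {w : List α | w.length = j} := by
  rintro w rfl v hv h
  rw [Set.mem_ofPred_eq] at hv
  refine List.ext_getElem? fun t => ?_
  rcases Nat.lt_or_ge t w.length with ht | ht
  · rw [← some_markedSeq (z := z) (o := o) (K := K) ht,
      ← some_markedSeq (z := z) (o := o) (K := K) (by omega)]
    have := congrArg (fun l : List α => l[K + 1 + t]?) h
    simp only [List.getElem?_map] at this
    rw [List.getElem?_range (by omega)] at this
    simpa using this
  · rw [List.getElem?_eq_none ht, List.getElem?_eq_none (by omega)]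

end MarkedSeq

theorem Hk_markedSeq_eq_zero {σ : ℕ} {z o : Fin σ} {K k m : ℕ} {w : List (Fin σ)} (hzo : z ≠ o)
    (hw : IsSync z K k w) (hK : 1 ≤ K) (hm : k + 2 * K ≤ m) (n : ℕ) :
    Hk ((List.range n).map (markedSeq z o K w)) m = 0 := by
  refine Hk_map_range_eq_zero _ _ _ fun i j h => ?_
  have := mod_eq_of_window hzo hw hK hm h
  rw [← markedSeq_mod, ← markedSeq_mod (j + m), Nat.add_mod, this, ← Nat.add_mod]

section Transducer

variable {Q α : Type*} (δ : Q → α → Q × List Bool)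

theorem stRun_append (q : Q) (x y : List α) :
    stRun δ q (x ++ y) = stRun δ (stRun δ q x) y := by
  induction x generalizing q with
  | nil => rfl
  | cons a x ih => exact ih _

theorem outRun_append (q : Q) (x y : List α) :
    outRun δ q (x ++ y) = outRun δ q x ++ outRun δ (stRun δ q x) y := by
  induction x generalizing q with
  | nil => rfl
  | cons a x ih => simp [outRun, stRun, ih]

theorem length_outRun_map_range (f : ℕ → α) (L : ℕ) (hf : ∀ i, f (i + L) = f i) (q : Q) (r : ℕ) :
    (outRun δ q ((List.range (r * L)).map f)).length = ∑ i ∈ Finset.range r,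
      (outRun δ (stRun δ q ((List.range (i * L)).map f)) ((List.range L).map f)).length := by
  induction r with
  | zero => simp [outRun]
  | succ r ih =>
    have hper : (f ∘ fun i => r * L + i) = f := by
      funext i
      simpa [add_comm, mul_comm] using Function.Periodic.nat_mul (f := f) hf r i
    rw [Finset.sum_range_succ, ← ih, add_one_mul, List.range_add, List.map_append, outRun_append,
      List.length_append, List.map_map, hper]

end Transducer

theorem finite_bool_lists (b : ℕ) : {l : List Bool | l.length ≤ b}.Finite :=
  List.finite_length_le Bool b

theorem ncard_bool_lists_le (b : ℕ) : {l : List Bool | l.length ≤ b}.ncard ≤ 2 ^ (b + 1) := by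
  have h : {l : List Bool | l.length ≤ b} ⊆ ↑((Finset.range (b + 1)).biUnion fun m =>
      (Finset.univ : Finset (List.Vector Bool m)).image List.Vector.toList) := by
    intro l hl
    rw [Set.mem_ofPred_eq] at hl
    simp only [Finset.coe_biUnion, Set.mem_iUnion]
    exact ⟨l.length, by simp; omega,
      Finset.mem_image.2 ⟨(⟨l, rfl⟩ : List.Vector Bool l.length), Finset.mem_univ _, rfl⟩⟩
  refine (Set.ncard_le_ncard h (Finset.finite_toSet _)).trans ?_
  rw [Set.ncard_coe_finset]
  refine Finset.card_biUnion_le.trans ?_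
  refine (Finset.sum_le_sum fun m _ => (Finset.card_image_le.trans (card_vector m).le)).trans ?_
  rw [Fintype.card_bool]
  rw [Nat.geomSum_eq le_rfl]
  simp

theorem ncard_le_of_short_outputs {Q α : Type*} [Fintype Q] (δ : Q → α → Q × List Bool) (q₀ : Q)
    {n L r b : ℕ} (hr : 1 ≤ r) (hrL : r * L ≤ n)
    (hinj : Set.InjOn (fun s => outRun δ q₀ s) {s : List α | s.length = n})
    {ι : Type*} (W : Set ι) (F : ι → ℕ → α) (hper : ∀ w ∈ W, ∀ i, F w (i + L) = F w i)
    (hF : Set.InjOn (fun w => (List.range L).map (F w)) W)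
    (hshort : ∀ w ∈ W, (outRun δ q₀ ((List.range n).map (F w))).length ≤ r * b) :
    W.ncard ≤ Fintype.card Q ^ 2 * 2 ^ (b + 1) := by
  have hex : ∀ w ∈ W, ∃ i < r,
      (outRun δ (stRun δ q₀ ((List.range (i * L)).map (F w))) ((List.range L).map (F w))).length
        ≤ b := by
    intro w hw
    by_contra! hc
    have h1 := hshort w hw
    rw [show n = r * L + (n - r * L) by omega, List.range_add, List.map_append, outRun_append,
      List.length_append, length_outRun_map_range δ (F w) L (hper w hw)] at h1
    have h2 : r • (b + 1) ≤ ∑ i ∈ Finset.range r,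
        (outRun δ (stRun δ q₀ ((List.range (i * L)).map (F w)))
          ((List.range L).map (F w))).length := by
      have := Finset.card_nsmul_le_sum (Finset.range r) (fun i => (outRun δ (stRun δ q₀
        ((List.range (i * L)).map (F w))) ((List.range L).map (F w))).length) (b + 1)
        (fun i hi => hc i (Finset.mem_range.1 hi))
      simpa using this
    rw [smul_eq_mul, mul_add] at h2
    omega
  choose! i hi hib using hex
  set P : ι → List α := fun w => (List.range (i w * L)).map (F w) with hP
  set D : ι → List α := fun w => (List.range L).map (F w) with hD
  have hle : W.ncard ≤ ((Set.univ : Set Q) ×ˢ ((Set.univ : Set Q) ×ˢ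
      {l : List Bool | l.length ≤ b})).ncard := by
    refine Set.ncard_le_ncard_of_injOn
      (fun w => (stRun δ q₀ (P w), stRun δ (stRun δ q₀ (P w)) (D w),
        outRun δ (stRun δ q₀ (P w)) (D w))) (fun w hw => ⟨trivial, trivial, hib w hw⟩) ?_
      (Set.finite_univ.prod (Set.finite_univ.prod (finite_bool_lists b)))
    intro w hw v hv h
    simp only [Prod.mk.injEq] at h
    obtain ⟨h1, h2, h3⟩ := h
    apply hF hw hv
    obtain ⟨x⟩ : Nonempty α := ⟨F w 0⟩
    set R : List α := List.replicate (n - (i w * L + L)) x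
    have hlen : i w * L + L ≤ n := by
      have : (i w + 1) * L ≤ r * L := Nat.mul_le_mul_right _ (hi w hw)
      rw [add_one_mul] at this
      omega
    have heq : P w ++ (D w ++ R) = P w ++ (D v ++ R) := by
      apply hinj
      · simp [hP, hD, R]; omega
      · simp [hP, hD, R]; omega
      · simp only [outRun_append]
        rw [← h1] at h2 h3
        rw [h2, h3]
    exact List.append_cancel_right (List.append_cancel_left heq)
  refine hle.trans ?_
  rw [Set.ncard_prod, Set.ncard_prod, Set.ncard_univ, Nat.card_eq_fintype_card, sq, mul_assoc]
  gcongr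
  exact ncard_bool_lists_le b

theorem ncard_le_of_short_outputs_of_injOn {α β : Type*} {W : Set α} (g : α → β)
    (e : β → List Bool) {b : ℕ} (hinj : Set.InjOn (e ∘ g) W)
    (hshort : ∀ w ∈ W, (e (g w)).length ≤ b) : W.ncard ≤ 2 ^ (b + 1) :=
  (Set.ncard_le_ncard_of_injOn (e ∘ g) hshort hinj (finite_bool_lists b)).trans
    (ncard_bool_lists_le b)

theorem eventually_mul_rpow_le {a b C D : ℝ} (hab : a < b) (hD : 0 < D) :
    ∀ᶠ n : ℕ in Filter.atTop, C * (n : ℝ) ^ a ≤ D * (n : ℝ) ^ b := by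
  have h := ((tendsto_rpow_atTop (sub_pos.2 hab)).comp
    tendsto_natCast_atTop_atTop).eventually_ge_atTop (C / D)
  filter_upwards [h, Filter.eventually_ge_atTop 1] with n hn h1
  have hpos : (0 : ℝ) < n := by exact_mod_cast h1
  simp only [Function.comp_apply, div_le_iff₀ hD] at hn
  rw [show b = (b - a) + a by ring, Real.rpow_add hpos, ← mul_assoc]
  gcongr
  rw [mul_comm]
  exact hn

theorem rpow_mul_le_pow_ceil {σ : ℕ} (hσ : 2 ≤ σ) {γ e : ℝ} (hγ : 0 < γ) {n m : ℕ} (hn : 1 ≤ n)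
    (hm : (m : ℝ) ≤ e * Real.logb σ n) :
    (n : ℝ) ^ (γ * e) ≤ ((σ : ℝ) ^ γ) ^ m * ((σ : ℝ) ^ γ) ^ (⌈e * Real.logb σ n⌉₊ - m) := by
  have hn' : (0 : ℝ) < n := by exact_mod_cast hn
  have hσ' : (1 : ℝ) < σ := by exact_mod_cast hσ
  have hle : m ≤ ⌈e * Real.logb σ n⌉₊ := by exact_mod_cast hm.trans (Nat.le_ceil _)
  rw [← pow_add, Nat.add_sub_cancel' hle, ← Real.rpow_natCast, ← Real.rpow_mul (by positivity)]
  conv_lhs => rw [← Real.rpow_logb (b := (σ : ℝ)) (by linarith) (ne_of_gt hσ') hn']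
  rw [← Real.rpow_mul (by positivity)]
  refine Real.rpow_le_rpow_of_exponent_le hσ'.le ?_
  have := mul_le_mul_of_nonneg_left (Nat.le_ceil (e * Real.logb σ n)) hγ.le
  linarith

theorem logb_two_mul_le {β : ℝ} (hβ : 0 < β) {j m : ℕ} (h : β ^ j ≤ 2 ^ m) :
    Real.logb 2 β * j ≤ m := by
  have := Real.logb_le_logb_of_le one_lt_two (by positivity) h
  rw [Real.logb_pow, Real.logb_pow, Real.logb_self_eq_one one_lt_two] at this
  linarith

/-- Lower bound of the memory-redundancy trade-off: with O(n^c) bits of memory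
(at most 2^⌈A·n^c⌉ states), any deterministic one-pass injective encoder must,
for all large n, output Ω(n) bits on some string s of length n with
H_k(s) = 0, where k = ⌈(c + ε/2)·log_σ n⌉; hence it cannot always encode in
O(n·H_k(s) + σ^k·n^(1-c-ε)) bits. -/
theorem stmt_14 (σ : ℕ) (hσ : 2 ≤ σ) (c ε A : ℝ)
    (hc0 : 0 ≤ c) (hc1 : c ≤ 1) (hε : 0 < ε) (hA : 0 < A) :
    ∃ B : ℝ, 0 < B ∧ ∃ N : ℕ, ∀ n : ℕ, N ≤ n →
      ∀ (Q : Type) (_ : Fintype Q) (δ : Q → Fin σ → Q × List Bool) (q0 : Q),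
        Fintype.card Q ≤ 2 ^ (Nat.ceil (A * (n : ℝ) ^ c)) →
        Set.InjOn (fun s => outRun δ q0 s) {s : List (Fin σ) | s.length = n} →
        ∃ s : List (Fin σ), s.length = n ∧
          Hk s (Nat.ceil ((c + ε / 2) * Real.logb σ n)) = 0 ∧
          B * n ≤ ((outRun δ q0 s).length : ℝ) := by
  set e := c + ε / 2 with he
  set e' := min (c + ε / 4) ((1 + c) / 2) with he'
  have he0 : 0 < e := by positivity
  have he'0 : 0 < e' := lt_min (by positivity) (by positivity)
  have he'1 : e' ≤ 1 := (min_le_right _ _).trans (by linarith)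
  have hee' : e' < e := (min_le_left _ _).trans_lt (by linarith)
  have hce' : c < 1 → c < e' := fun h => lt_min (by linarith) (by linarith)
  obtain ⟨γ, hγ0, hγ1, hγ⟩ : ∃ γ : ℝ, 0 < γ ∧ γ < 1 ∧ e' < γ * e := by
    have h1 : e' / e < 1 := (div_lt_one he0).2 hee'
    have h2 : 0 < e' / e := div_pos he'0 he0
    have h3 : e' / e * e = e' := div_mul_cancel₀ _ he0.ne'
    exact ⟨(e' / e + 1) / 2, by linarith, by linarith, by linarith⟩
  have hσ' : (1 : ℝ) < σ := by exact_mod_cast hσ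
  set β : ℝ := (σ : ℝ) ^ γ with hβdef
  have hβ1 : 1 < β := Real.one_lt_rpow hσ' hγ0
  have hβ0 : 0 < β := by linarith
  have hβσ : β < σ := by
    simpa using Real.rpow_lt_rpow_of_exponent_lt hσ' hγ1
  set θ := Real.logb 2 β with hθdef
  have hθ : 0 < θ := Real.logb_pos one_lt_two hβ1
  obtain ⟨K', hK'⟩ := exists_pow_lt_of_lt_one (show 0 < (σ - β) / 2 by linarith)
    (inv_lt_one_of_one_lt₀ hβ1)
  obtain ⟨K, hK1, hK⟩ : ∃ K : ℕ, 1 ≤ K ∧ 1 / β ^ (K - 1) ≤ (σ - β) / 2 :=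
    ⟨K' + 1, by omega, by simpa using hK'.le⟩
  refine ⟨θ / 4, by positivity, ?_⟩
  have hlog : Filter.Tendsto (fun n : ℕ => e * Real.logb σ n) Filter.atTop Filter.atTop :=
    ((Real.tendsto_logb_atTop hσ').comp tendsto_natCast_atTop_atTop).const_mul_atTop he0
  have hx : Filter.Tendsto (fun n : ℕ => (n : ℝ) ^ e') Filter.atTop Filter.atTop :=
    (tendsto_rpow_atTop he'0).comp tendsto_natCast_atTop_atTop
  have hmem : ∀ᶠ n : ℕ in Filter.atTop, c < 1 →
      2 * A * (n : ℝ) ^ c ≤ θ / 8 * (n : ℝ) ^ e' := by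
    by_cases h : c < 1
    · filter_upwards [eventually_mul_rpow_le (C := 2 * A) (hce' h)
        (show 0 < θ / 8 by positivity)] with n hn _ using hn
    · exact Filter.Eventually.of_forall fun n h' => absurd h' h
  obtain ⟨N, hN⟩ := Filter.eventually_atTop.1 ((Filter.eventually_ge_atTop 1).and
    ((hlog.eventually_ge_atTop ((2 * K + 1 : ℕ) : ℝ)).and
    ((hx.eventually_ge_atTop (((K : ℝ) + 4) * 8 + 64 / θ)).and (hmem.and
    (eventually_mul_rpow_le (C := β ^ (2 * K + 1)) hγ (show 0 < (σ - β) / 2 by linarith))))))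
  refine ⟨N, fun n hn Q _ δ q₀ hQ hinj => ?_⟩
  obtain ⟨hn1, hk₀, hxn, hmem, hgrow⟩ := hN n hn
  have hn0 : (1 : ℝ) ≤ n := by exact_mod_cast hn1
  set x := (n : ℝ) ^ e' with hxdef
  have hx0 : 0 < x := by positivity
  have hxle : x ≤ n := by
    simpa using Real.rpow_le_rpow_of_exponent_le hn0 he'1
  set L := ⌊x⌋₊ with hL
  have hLx : (L : ℝ) ≤ x := Nat.floor_le hx0.le
  have hxL : x < L + 1 := Nat.lt_floor_add_one x
  have hθ64 : 0 < 64 / θ := by positivity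
  have hKL : K + 2 ≤ L := Nat.le_floor (by push_cast; linarith [(Nat.cast_nonneg K : (0 : ℝ) ≤ K)])
  have hLn : L ≤ n := by exact_mod_cast hLx.trans hxle
  set k₀ := ⌈e * Real.logb σ n⌉₊ with hk₀def
  have hk₀' : 2 * K + 1 ≤ k₀ := by exact_mod_cast hk₀.trans (Nat.le_ceil _)
  set k := k₀ - 2 * K with hkdef
  have hrate : 1 / β ^ (K - 1) + L / β ^ (k - 1) + β ≤ Fintype.card (Fin σ) := by
    have h1 := rpow_mul_le_pow_ceil hσ hγ0 hn1 hk₀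
    rw [← hβdef, ← hk₀def, show k₀ - (2 * K + 1) = k - 1 by omega] at h1
    have h2 : (L : ℝ) / β ^ (k - 1) ≤ (σ - β) / 2 := by
      rw [div_le_iff₀ (by positivity)]
      have h3 := mul_le_mul_of_nonneg_left h1 (show 0 ≤ (σ - β) / 2 by linarith)
      have h4 : β ^ (2 * K + 1) * x ≤ β ^ (2 * K + 1) * ((σ - β) / 2 * β ^ (k - 1)) := by
        refine hgrow.trans (h3.trans_eq ?_)
        ring
      exact hLx.trans (le_of_mul_le_mul_left h4 (by positivity))
    rw [Fintype.card_fin]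
    linarith
  set z : Fin σ := ⟨0, by omega⟩ with hz
  set o : Fin σ := ⟨1, by omega⟩ with ho
  have hzo : z ≠ o := by simp [hz, ho]
  set W := syncWords z K k (L - K - 2) with hW
  have hWcard : β ^ (L - K - 2) ≤ W.ncard :=
    pow_le_ncard_syncWords z hK1 (by omega) hβ0 hrate _ (by omega)
  by_contra! hcon
  have hshort : ∀ w ∈ W, ((outRun δ q₀ ((List.range n).map (markedSeq z o K w))).length : ℝ)
      ≤ θ / 4 * n := fun w hw =>
    (hcon _ (by simp) (Hk_markedSeq_eq_zero hzo hw.2 hK1 (by omega) n)).le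
  have hWinj : Set.InjOn (fun w => (List.range L).map (markedSeq z o K w)) W := by
    have := map_markedSeq_injOn z o K (L - K - 2)
    rw [show K + (L - K - 2) + 2 = L by omega] at this
    exact this.mono fun w hw => hw.1
  have hcast : ((L - K - 2 : ℕ) : ℝ) = L - K - 2 := by
    rw [Nat.sub_sub, Nat.cast_sub (by omega)]
    push_cast
    ring
  have hθx : θ * (((K : ℝ) + 4) * 8) + 64 ≤ θ * x := by
    have := mul_le_mul_of_nonneg_left hxn hθ.le
    rwa [mul_add, mul_div_cancel₀ _ hθ.ne'] at this
  have hθL : θ * x ≤ θ * (L + 1) := by gcongr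
  have hθK : 0 ≤ θ * K := by positivity
  rcases hc1.lt_or_eq with hc | hc
  · set r := n / L with hr
    set b := ⌈θ / 2 * L⌉₊ with hb
    have hr1 : 1 ≤ r := (Nat.one_le_div_iff (by omega)).2 hLn
    have hn2 : (n : ℝ) ≤ 2 * (r * L) := by
      have h1 := Nat.lt_div_mul_add (a := n) (show 0 < L by omega)
      rw [← hr] at h1
      have h2 : 1 * L ≤ r * L := Nat.mul_le_mul_right _ hr1
      exact_mod_cast (show n ≤ 2 * (r * L) by omega)
    have hcount := ncard_le_of_short_outputs δ q₀ hr1 (Nat.div_mul_le_self n L) (b := b) hinj W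
      (markedSeq z o K) (fun w hw i => by
        have hLw : L = K + w.length + 2 := by rw [hw.1]; omega
        rw [← markedSeq_mod, ← markedSeq_mod i, ← hLw, Nat.add_mod_right]) hWinj
      (fun w hw => by
        have h1 := Nat.le_ceil (θ / 2 * L)
        have h2 : (r : ℝ) * (θ / 2 * L) ≤ r * b := by gcongr
        have h3 := mul_le_mul_of_nonneg_left hn2 (show 0 ≤ θ / 4 by positivity)
        have h4 := hshort w hw
        have h5 : ((outRun δ q₀ ((List.range n).map (markedSeq z o K w))).length : ℝ)
          ≤ r * b := by linarith
        exact_mod_cast h5)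
    have hcount' : W.ncard ≤ 2 ^ (2 * ⌈A * (n : ℝ) ^ c⌉₊ + (b + 1)) := by
      refine hcount.trans ?_
      rw [pow_add 2 (2 * _), mul_comm 2, pow_mul]
      gcongr
    have h1 := logb_two_mul_le hβ0 (hWcard.trans (by exact_mod_cast hcount'))
    rw [hcast, ← hθdef] at h1
    push_cast at h1
    have h2 := Nat.ceil_lt_add_one (show 0 ≤ A * (n : ℝ) ^ c by positivity)
    have h3 := Nat.ceil_lt_add_one (show 0 ≤ θ / 2 * L by positivity)
    have h4 := hmem hc
    have h5 : θ * L ≤ θ * x := by gcongr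
    linarith
  · have hLn' : L = n := by
      have : e' = 1 := le_antisymm he'1 (le_min (by linarith) (by linarith))
      rw [hL, hxdef, this, Real.rpow_one, Nat.floor_natCast]
    set b := ⌈θ / 4 * n⌉₊ with hb
    rw [hLn'] at hWinj
    have hcount := ncard_le_of_short_outputs_of_injOn (W := W) (b := b)
      (fun w => (List.range n).map (markedSeq z o K w)) (outRun δ q₀)
      (hinj.comp hWinj fun w _ => by simp)
      (fun w hw => by exact_mod_cast (hshort w hw).trans (Nat.le_ceil _))
    have h1 := logb_two_mul_le hβ0 (hWcard.trans (by exact_mod_cast hcount))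
    rw [hcast, ← hθdef] at h1
    push_cast at h1
    have h3 := Nat.ceil_lt_add_one (show 0 ≤ θ / 4 * n by positivity)
    have h4 : (L : ℝ) = n := by exact_mod_cast hLn'
    rw [h4] at h1 hθL
    linarith
end
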